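/- Let U_m and U_t be unicyclic graphs on m and t vertices respectively, with m, t ≥ 5 and m + t = n. Then PS(U_m ⊔ U_t) < 54·F(n−6) + 18·F(n−7). -/

import Mathlib

open SimpleGraph Finset
open scoped Classical

noncomputable section

namespace PermSum

variable {V W : Type*}

/-- Number of cycle components of the spanning subgraph with edge set `M`:
components all of whose vertices have degree `2`. -/
noncomputable def numCycles [Fintype V] (M : Finset (Sym2 V)) : ℕ :=
  Nat.card {c : (fromEdgeSet (↑M : Set (Sym2 V))).ConnectedComponent //
    ∀ v, (fromEdgeSet (↑M : Set (Sym2 V))).connectedComponentMk v = c →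
      (fromEdgeSet (↑M : Set (Sym2 V))).degree v = 2}

/-- `M` is the edge set of a Sachs subgraph of `G`: each component of the graph it spans is a
single edge or a cycle (every covered vertex has degree 1 or 2, and any vertex of degree 1 has
its neighbours of degree 1). -/
def IsSachs [Fintype V] (G : SimpleGraph V) (M : Finset (Sym2 V)) : Prop :=
  (↑M : Set (Sym2 V)) ⊆ G.edgeSet ∧
  (∀ v ∈ (fromEdgeSet (↑M : Set (Sym2 V))).support,
      (fromEdgeSet (↑M : Set (Sym2 V))).degree v = 1 ∨
      (fromEdgeSet (↑M : Set (Sym2 V))).degree v = 2) ∧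
  (∀ v w, (fromEdgeSet (↑M : Set (Sym2 V))).Adj v w →
      (fromEdgeSet (↑M : Set (Sym2 V))).degree v = 1 →
      (fromEdgeSet (↑M : Set (Sym2 V))).degree w = 1)

/-- The permanental sum of a finite simple graph: `∑_H 2^{c(H)}` over all Sachs subgraphs `H`
(including the empty one). -/
noncomputable def PS [Fintype V] (G : SimpleGraph V) : ℕ :=
  ∑ M ∈ Finset.univ.filter (fun M : Finset (Sym2 V) => IsSachs G M), 2 ^ numCycles M


/-- The matchings of `G` all of whose edges have both ends in `S`. -/
def matchings [Fintype V] (G : SimpleGraph V) (S : Finset V) : Finset (Finset (Sym2 V)) :=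
  Finset.univ.filter fun M =>
    (∀ f ∈ M, f ∈ G.edgeSet ∧ ∀ v ∈ f, v ∈ S) ∧ ∀ f ∈ M, ∀ g ∈ M, ∀ v, v ∈ f → v ∈ g → f = g

lemma mem_matchings [Fintype V] {G : SimpleGraph V} {S : Finset V} {M : Finset (Sym2 V)} :
    M ∈ matchings G S ↔ (∀ f ∈ M, f ∈ G.edgeSet ∧ ∀ v ∈ f, v ∈ S) ∧
      ∀ f ∈ M, ∀ g ∈ M, ∀ v, v ∈ f → v ∈ g → f = g := by
  simp [matchings]

lemma card_matchings_empty [Fintype V] (G : SimpleGraph V) : #(matchings G ∅) ≤ 1 := by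
  rw [Finset.card_le_one]
  have key : ∀ M ∈ matchings G ∅, M = ∅ := by
    intro M hM
    rw [mem_matchings] at hM
    refine Finset.eq_empty_of_forall_notMem fun f hf => ?_
    induction f with | _ a b => simpa using (hM.1 _ hf).2 a (by simp)
  intro M hM N hN
  rw [key M hM, key N hN]

/-- Matchings avoiding the edge `xy` and matchings using it. -/
lemma card_matchings_le_deleteEdge [Fintype V] (G : SimpleGraph V) (S : Finset V) (x y : V) :
    #(matchings G S) ≤ #(matchings (G.deleteEdges {s(x, y)}) S) +
      #(matchings G ((S.erase x).erase y)) := by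
  rw [← Finset.card_filter_add_card_filter_not (s := matchings G S) (fun M => s(x, y) ∉ M)]
  refine add_le_add (Finset.card_le_card fun M hM => ?_) ?_
  · simp only [Finset.mem_filter, mem_matchings] at hM ⊢
    refine ⟨fun f hf => ⟨?_, (hM.1.1 f hf).2⟩, hM.1.2⟩
    rw [edgeSet_deleteEdges]
    refine ⟨(hM.1.1 f hf).1, fun h => hM.2 ?_⟩
    rwa [← Set.mem_singleton_iff.1 h]
  · refine Finset.card_le_card_of_injOn (fun M => M.erase s(x, y)) (fun M hM => ?_) ?_
    · simp only [Finset.coe_filter, Set.mem_ofPred_eq, mem_matchings, not_not, Finset.mem_coe,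
        Finset.mem_erase] at hM ⊢
      obtain ⟨⟨h1, h2⟩, h3⟩ := hM
      refine ⟨fun f hf => ⟨(h1 f hf.2).1, fun v hv => ⟨?_, ?_, (h1 f hf.2).2 v hv⟩⟩,
        fun f hf g hg => h2 f hf.2 g hg.2⟩
      · rintro rfl
        exact hf.1 (h2 f hf.2 _ h3 v hv (by simp))
      · rintro rfl
        exact hf.1 (h2 f hf.2 _ h3 v hv (by simp))
    · intro M hM N hN h
      simp only [Finset.coe_filter, Set.mem_ofPred_eq, not_not] at hM hN
      rw [← Finset.insert_erase hM.2, ← Finset.insert_erase hN.2]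
      exact congrArg _ h

lemma card_matchings_le_erase_of_isolated [Fintype V] {G : SimpleGraph V} {S : Finset V} {v : V}
    (h : ∀ w ∈ S, ¬ G.Adj v w) : #(matchings G S) ≤ #(matchings G (S.erase v)) := by
  refine Finset.card_le_card fun M hM => ?_
  rw [mem_matchings] at hM ⊢
  refine ⟨fun f hf => ⟨(hM.1 f hf).1, fun w hw => ?_⟩, hM.2⟩
  obtain ⟨h1, h2⟩ := hM.1 f hf
  refine Finset.mem_erase.2 ⟨?_, h2 w hw⟩
  rintro rfl
  obtain ⟨u, rfl⟩ := Sym2.mem_iff_exists.1 hw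
  exact h u (h2 u (by simp)) h1

lemma card_matchings_deleteEdges_le [Fintype V] (G : SimpleGraph V) (s : Set (Sym2 V))
    (S : Finset V) : #(matchings (G.deleteEdges s) S) ≤ #(matchings G S) := by
  refine Finset.card_le_card fun M hM => ?_
  rw [mem_matchings] at hM ⊢
  refine ⟨fun f hf => ⟨?_, (hM.1 f hf).2⟩, hM.2⟩
  have := (hM.1 f hf).1
  rw [edgeSet_deleteEdges] at this
  exact this.1

lemma card_matchings_le_of_leaf [Fintype V] {G : SimpleGraph V} {S : Finset V} {v u : V}
    (h : ∀ w ∈ S, G.Adj v w → w = u) :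
    #(matchings G S) ≤ #(matchings G (S.erase v)) + #(matchings G ((S.erase v).erase u)) := by
  refine (card_matchings_le_deleteEdge G S v u).trans (Nat.add_le_add_right ?_ _)
  refine (card_matchings_le_erase_of_isolated (v := v) fun w hw hvw => ?_).trans
    (card_matchings_deleteEdges_le _ _ _)
  rw [deleteEdges_adj] at hvw
  obtain rfl := h w hw hvw.1
  exact hvw.2 rfl

/-- A forest on `k` vertices, presented by a rank function and a parent function, has at most
`F (k + 1)` matchings. -/
lemma card_matchings_forest_le [Fintype V] {G : SimpleGraph V} (d : V → ℕ) (p : V → V)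
    (S : Finset V) (h : ∀ v ∈ S, ∀ w ∈ S, G.Adj v w → d w ≤ d v → w = p v) :
    #(matchings G S) ≤ Nat.fib (#S + 1) := by
  induction hk : #S using Nat.strong_induction_on generalizing S with
  | _ k ih =>
  subst hk
  obtain rfl | hS := S.eq_empty_or_nonempty
  · exact card_matchings_empty G
  obtain ⟨v, hv, hmax⟩ := Finset.exists_max_image S d hS
  have hleaf : ∀ w ∈ S, G.Adj v w → w = p v := fun w hw hvw => h v hv w hw hvw (hmax w hw)
  have ih' : ∀ T ⊂ S, #(matchings G T) ≤ Nat.fib (#T + 1) := fun T hT =>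
    ih _ (Finset.card_lt_card hT) T
      (fun a ha b hb => h a (hT.1 ha) b (hT.1 hb)) rfl
  have h1 := ih' _ (Finset.erase_ssubset hv)
  have hc := Finset.card_erase_add_one hv
  by_cases hp : p v ∈ S.erase v
  · have h2 := ih' _ ((Finset.erase_ssubset hp).trans (Finset.erase_ssubset hv))
    have hc2 := Finset.card_erase_add_one hp
    have := card_matchings_le_of_leaf hleaf
    rw [← hc, ← hc2, Nat.fib_add_two]
    rw [← hc2] at h1
    omega
  · refine (card_matchings_le_erase_of_isolated fun w hw hvw => hp ?_).trans
      (h1.trans (Nat.fib_mono (by omega)))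
    rw [← hleaf w hw hvw]
    exact Finset.mem_erase.2 ⟨hvw.ne', hw⟩

/-- A connected graph with as many edges as vertices is, up to one edge, described by the
parent function of a breadth-first search from any root. -/
lemma exists_parent [Fintype V] {G : SimpleGraph V} (hc : G.Connected)
    (he : G.edgeFinset.card = Fintype.card V) (r : V) :
    ∃ x y, G.Adj x y ∧ ∃ p : V → V, ∀ v w, G.Adj v w → G.dist w r ≤ G.dist v r →
      s(v, w) ≠ s(x, y) → w = p v ∧ G.dist w r < G.dist v r := by
  have hpar : ∀ v, ∃ w, v ≠ r → G.Adj v w ∧ G.dist w r < G.dist v r := by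
    intro v
    by_cases hv : v = r
    · exact ⟨v, fun h => (h hv).elim⟩
    obtain ⟨q, hq⟩ := hc.exists_walk_length_eq_dist v r
    cases q with
    | nil => exact (hv rfl).elim
    | @cons _ w _ hvw q =>
      refine ⟨w, fun _ => ⟨hvw, ?_⟩⟩
      have := dist_le q
      rw [Walk.length_cons] at hq
      omega
  choose p hp using hpar
  set T := (Finset.univ.erase r).image fun v => s(v, p v) with hT
  have hTsub : T ⊆ G.edgeFinset := by
    intro f hf
    obtain ⟨v, hv, rfl⟩ := Finset.mem_image.1 hf
    rw [mem_edgeFinset]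
    exact (hp v (Finset.ne_of_mem_erase hv)).1
  have hTcard : #T + 1 = Fintype.card V := by
    rw [hT, Finset.card_image_of_injOn, Finset.card_erase_add_one (Finset.mem_univ r),
      Finset.card_univ]
    intro v hv w hw hvw
    have h1 := (hp v (Finset.ne_of_mem_erase hv)).2
    have h2 := (hp w (Finset.ne_of_mem_erase hw)).2
    rcases Sym2.eq_iff.1 hvw with h | h
    · exact h.1
    · rw [h.2] at h1
      rw [← h.1] at h2
      omega
  have hone : #(G.edgeFinset \ T) = 1 := by
    rw [Finset.card_sdiff_of_subset hTsub]
    omega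
  obtain ⟨e, hee⟩ := Finset.card_eq_one.1 hone
  have hmem : e ∈ G.edgeFinset \ T := by simp [hee]
  induction e with | _ x y =>
  refine ⟨x, y, by simpa using (Finset.mem_sdiff.1 hmem).1, p, fun v w hvw hd hne => ?_⟩
  have hvT : s(v, w) ∈ T := by
    by_contra hcon
    have : s(v, w) ∈ G.edgeFinset \ T :=
      Finset.mem_sdiff.2 ⟨by simpa using hvw, hcon⟩
    rw [hee, Finset.mem_singleton] at this
    exact hne this
  obtain ⟨u, hu, huv⟩ := Finset.mem_image.1 hvT
  have h1 := (hp u (Finset.ne_of_mem_erase hu)).2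
  rcases Sym2.eq_iff.1 huv with ⟨rfl, rfl⟩ | ⟨rfl, h⟩
  · exact ⟨rfl, h1⟩
  · rw [h] at h1
    omega

lemma card_matchings_unicyclic_le [Fintype V] {G : SimpleGraph V} (hc : G.Connected)
    (he : G.edgeFinset.card = Fintype.card V) (S : Finset V) :
    #(matchings G S) ≤ Nat.fib (#S + 1) + Nat.fib (#S - 1) := by
  obtain ⟨r⟩ := hc.nonempty
  obtain ⟨x, y, hxy, p, hp⟩ := exists_parent hc he r
  by_cases h : x ∈ S ∧ y ∈ S
  · refine (card_matchings_le_deleteEdge G S x y).trans (add_le_add ?_ ?_)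
    · refine card_matchings_forest_le (G.dist · r) p S fun v _ w _ hvw hd => ?_
      rw [deleteEdges_adj] at hvw
      exact (hp v w hvw.1 hd fun h => hvw.2 h).1
    · have hy : y ∈ S.erase x := Finset.mem_erase.2 ⟨hxy.ne', h.2⟩
      have h1 := Finset.card_erase_add_one h.1
      have h2 := Finset.card_erase_add_one hy
      have : #S - 1 = #((S.erase x).erase y) + 1 := by omega
      rw [this]
      refine card_matchings_forest_le (G.dist · r) p _ fun v hv w hw hvw hd =>
        (hp v w hvw hd ?_).1
      intro hcon
      have : y ∈ s(v, w) := by simp [hcon]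
      rcases Sym2.mem_iff.1 this with rfl | rfl
      · exact Finset.ne_of_mem_erase hv rfl
      · exact Finset.ne_of_mem_erase hw rfl
  · refine (card_matchings_forest_le (G.dist · r) p S fun v hv w hw hvw hd =>
      (hp v w hvw hd fun hcon => h ?_).1).trans (Nat.le_add_right _ _)
    rcases Sym2.eq_iff.1 hcon with ⟨rfl, rfl⟩ | ⟨rfl, rfl⟩
    · exact ⟨hv, hw⟩
    · exact ⟨hw, hv⟩

/-- Breadth-first search from a vertex of a triangle: the edge opposite to the root is the only
one that is not a parent edge. -/
lemma exists_parent_triangle [Fintype V] {G : SimpleGraph V} (hc : G.Connected)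
    (he : G.edgeFinset.card = Fintype.card V) {x y z : V} (hxy : G.Adj x y) (hxz : G.Adj x z)
    (hyz : G.Adj y z) :
    ∃ p : V → V, ∀ v w, G.Adj v w → G.dist w z ≤ G.dist v z → s(v, w) ≠ s(x, y) → w = p v := by
  obtain ⟨a, b, -, p, hp⟩ := exists_parent hc he z
  have hx := dist_eq_one_iff_adj.2 hxz
  have hy := dist_eq_one_iff_adj.2 hyz
  have hab : s(x, y) = s(a, b) := by
    by_contra hcon
    have := (hp x y hxy (by omega) hcon).2
    omega
  exact ⟨p, fun v w hvw hd hne => (hp v w hvw hd (hab ▸ hne)).1⟩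

lemma card_matchings_le_of_notMem_triangle [Fintype V] {G : SimpleGraph V} (hc : G.Connected)
    (he : G.edgeFinset.card = Fintype.card V) {x y z : V} (hxy : G.Adj x y) (hxz : G.Adj x z)
    (hyz : G.Adj y z) {S : Finset V} (hx : x ∉ S) : #(matchings G S) ≤ Nat.fib (#S + 1) := by
  obtain ⟨p, hp⟩ := exists_parent_triangle hc he hxy hxz hyz
  refine card_matchings_forest_le (G.dist · z) p S fun v hv w hw hvw hd => hp v w hvw hd ?_
  intro hcon
  have : x ∈ s(v, w) := by simp [hcon]
  rcases Sym2.mem_iff.1 this with rfl | rfl <;> contradiction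

lemma card_matchings_triangle_le [Fintype V] {G : SimpleGraph V} (hc : G.Connected)
    (he : G.edgeFinset.card = Fintype.card V) {x y z : V} (hxy : G.Adj x y) (hxz : G.Adj x z)
    (hyz : G.Adj y z) (j : ℕ) (S : Finset V) (hS : {x, y, z} ⊆ S) (hj : #S = j + 3) :
    #(matchings G S) + 2 * #(matchings G (S \ {x, y, z})) ≤
      6 * Nat.fib (j + 1) + 2 * Nat.fib j := by
  have hT : #({x, y, z} : Finset V) = 3 :=
    Finset.card_eq_three.2 ⟨x, y, z, hxy.ne, hxz.ne, hyz.ne, rfl⟩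
  have hmiss : ∀ u ∈ ({x, y, z} : Finset V), ∀ R : Finset V, u ∉ R →
      #(matchings G R) ≤ Nat.fib (#R + 1) := by
    intro u hu R hR
    simp only [Finset.mem_insert, Finset.mem_singleton] at hu
    rcases hu with rfl | rfl | rfl
    · exact card_matchings_le_of_notMem_triangle hc he hxy hxz hyz hR
    · exact card_matchings_le_of_notMem_triangle hc he hxy.symm hyz hxz hR
    · exact card_matchings_le_of_notMem_triangle hc he hxz.symm hyz.symm hxy hR
  induction j using Nat.strong_induction_on generalizing S with
  | _ j ih =>
  cases j with
  | zero =>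
    have h1 := card_matchings_unicyclic_le hc he S
    have : S \ {x, y, z} = ∅ := by
      rw [Finset.eq_of_subset_of_card_le hS (by omega), Finset.sdiff_self]
    have h2 := card_matchings_empty G
    rw [this]
    rw [hj] at h1
    have h4 : Nat.fib (0 + 3 + 1) = 3 := rfl
    have h5 : Nat.fib (0 + 3 - 1) = 1 := rfl
    rw [h4, h5] at h1
    simp only [Nat.fib_zero, zero_add, Nat.fib_one]
    omega
  | succ j =>
    obtain ⟨p, hp⟩ := exists_parent_triangle hc he hxy hxz hyz
    have hne : (S \ {x, y, z}).Nonempty := by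
      rw [← Finset.card_pos, Finset.card_sdiff_of_subset hS]
      omega
    obtain ⟨v, hv, hmax⟩ := Finset.exists_max_image _ (G.dist · z) hne
    obtain ⟨hvS, hvT⟩ := Finset.mem_sdiff.1 hv
    have hvx : v ≠ x := by rintro rfl; simp at hvT
    have hvy : v ≠ y := by rintro rfl; simp at hvT
    have hvz : v ≠ z := by rintro rfl; simp at hvT
    have hleaf : ∀ w ∈ S, G.Adj v w → w = p v := by
      intro w hw hvw
      refine hp v w hvw ?_ ?_
      · by_cases hwT : w ∈ ({x, y, z} : Finset V)
        · have hpos := hc.pos_dist_of_ne hvz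
          have hx := dist_eq_one_iff_adj.2 hxz
          have hy := dist_eq_one_iff_adj.2 hyz
          simp only [Finset.mem_insert, Finset.mem_singleton] at hwT
          rcases hwT with rfl | rfl | rfl
          · omega
          · omega
          · simp
        · exact hmax w (Finset.mem_sdiff.2 ⟨hw, hwT⟩)
      · intro hcon
        have : v ∈ s(x, y) := by simp [← hcon]
        rcases Sym2.mem_iff.1 this with rfl | rfl <;> contradiction
    have hleaf' : ∀ w ∈ S \ {x, y, z}, G.Adj v w → w = p v := fun w hw =>
      hleaf w (Finset.mem_sdiff.1 hw).1
    have hcv := Finset.card_erase_add_one hvS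
    have hsub : {x, y, z} ⊆ S.erase v := fun a ha =>
      Finset.mem_erase.2 ⟨fun h => hvT (h ▸ ha), hS ha⟩
    have ih1 := ih j (by omega) (S.erase v) hsub (by omega)
    rw [Finset.erase_sdiff_comm] at ih1
    have f1 : Nat.fib (j + 1 + 1) = Nat.fib j + Nat.fib (j + 1) := Nat.fib_add_two
    by_cases hpS : p v ∈ S.erase v
    · have hcp := Finset.card_erase_add_one hpS
      have m1 := card_matchings_le_of_leaf hleaf
      by_cases hpT : p v ∈ ({x, y, z} : Finset V)
      · have m2 := hmiss _ hpT ((S.erase v).erase (p v)) (Finset.notMem_erase _ _)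
        have m3 : #(matchings G (S \ {x, y, z})) ≤ #(matchings G ((S \ {x, y, z}).erase v)) := by
          refine card_matchings_le_erase_of_isolated fun w hw hvw => ?_
          obtain rfl := hleaf' w hw hvw
          exact (Finset.mem_sdiff.1 hw).2 hpT
        have hc2 : #((S.erase v).erase (p v)) + 1 = j + 3 := by omega
        have f2 : Nat.fib (j + 3) = Nat.fib (j + 1) + Nat.fib (j + 2) := Nat.fib_add_two
        have f3 : Nat.fib (j + 2) = Nat.fib j + Nat.fib (j + 1) := Nat.fib_add_two
        rw [hc2] at m2
        omega
      · have m3 := card_matchings_le_of_leaf hleaf'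
        have hsub2 : {x, y, z} ⊆ (S.erase v).erase (p v) := fun a ha =>
          Finset.mem_erase.2 ⟨fun h => hpT (h ▸ ha), hsub ha⟩
        have hc3 := Finset.card_le_card hsub2
        obtain ⟨i, rfl⟩ : ∃ i, j = i + 1 := ⟨j - 1, by omega⟩
        have ih2 := ih i (by omega) _ hsub2 (by omega)
        rw [Finset.erase_sdiff_comm, Finset.erase_sdiff_comm] at ih2
        have f2 : Nat.fib (i + 1 + 1) = Nat.fib i + Nat.fib (i + 1) := Nat.fib_add_two
        omega
    · have hiso : ∀ w ∈ S, ¬ G.Adj v w := fun w hw hvw =>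
        hpS (hleaf w hw hvw ▸ Finset.mem_erase.2 ⟨hvw.ne', hw⟩)
      have m1 := card_matchings_le_erase_of_isolated hiso
      have m2 := card_matchings_le_erase_of_isolated (G := G) (S := S \ {x, y, z}) (v := v)
        fun w hw => hiso w (Finset.mem_sdiff.1 hw).1
      have f2 : Nat.fib j ≤ Nat.fib (j + 1) := Nat.fib_le_fib_succ
      omega

/-- The graph spanned by an edge set. -/
abbrev spanned (M : Finset (Sym2 V)) : SimpleGraph V := fromEdgeSet (↑M : Set (Sym2 V))

lemma spanned_adj {M : Finset (Sym2 V)} {v w : V} :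
    (spanned M).Adj v w ↔ s(v, w) ∈ M ∧ v ≠ w := by
  simp [spanned]

/-- The union of the cycles of a Sachs subgraph: the edges both ends of which have degree `2`. -/
def cyclePart [Fintype V] (M : Finset (Sym2 V)) : SimpleGraph V where
  Adj v w := (spanned M).Adj v w ∧ (spanned M).degree v = 2 ∧ (spanned M).degree w = 2
  symm := ⟨fun _ _ h => ⟨h.1.symm, h.2.2, h.2.1⟩⟩
  loopless := ⟨fun _ h => h.1.ne rfl⟩

lemma exists_two_adj_of_degree_eq_two [Fintype V] {G : SimpleGraph V} [DecidableRel G.Adj]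
    {v : V} (h : G.degree v = 2) (w : V) : ∃ w' ≠ w, G.Adj v w' := by
  rw [← card_neighborFinset_eq_degree] at h
  obtain ⟨w', hw', hne⟩ := Finset.exists_mem_ne (by omega : 1 < #(G.neighborFinset v)) w
  exact ⟨w', hne, by simpa using hw'⟩

namespace IsSachs

variable [Fintype V] {G : SimpleGraph V} {M N : Finset (Sym2 V)}

lemma adj_of_mem (hM : IsSachs G M) {v w : V} (h : s(v, w) ∈ M) : G.Adj v w :=
  hM.1 h

lemma spanned_adj_iff (hM : IsSachs G M) {v w : V} : (spanned M).Adj v w ↔ s(v, w) ∈ M :=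
  spanned_adj.trans ⟨And.left, fun h => ⟨h, (hM.adj_of_mem h).ne⟩⟩

lemma spanned_le (hM : IsSachs G M) : spanned M ≤ G := fun _ _ h =>
  hM.adj_of_mem (hM.spanned_adj_iff.1 h)

lemma degree_eq_two_of_adj (hM : IsSachs G M) {v w : V} (h : (spanned M).Adj v w)
    (hv : (spanned M).degree v = 2) : (spanned M).degree w = 2 := by
  refine (hM.2.1 w ⟨v, h.symm⟩).resolve_left fun hw => ?_
  exact absurd (hv.symm.trans (hM.2.2 w v h.symm hw)) (by norm_num)

lemma degree_eq_one_of_adj (hM : IsSachs G M) {v w : V} (h : (spanned M).Adj v w)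
    (hv : (spanned M).degree v ≠ 2) : (spanned M).degree v = 1 :=
  (hM.2.1 v ⟨w, h⟩).resolve_right hv

lemma cyclePart_adj_iff (hM : IsSachs G M) {v w : V} (hv : (spanned M).degree v = 2) :
    (cyclePart M).Adj v w ↔ (spanned M).Adj v w :=
  ⟨fun h => h.1, fun h => ⟨h, hv, hM.degree_eq_two_of_adj h hv⟩⟩

lemma exists_cyclePart_adj (hM : IsSachs G M) {v : V} (hv : (spanned M).degree v = 2) (w : V) :
    ∃ w' ≠ w, (cyclePart M).Adj v w' := by
  obtain ⟨w', hne, h⟩ := exists_two_adj_of_degree_eq_two hv w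
  exact ⟨w', hne, (hM.cyclePart_adj_iff hv).2 h⟩

lemma cyclePart_le (hM : IsSachs G M) : cyclePart M ≤ G := fun _ _ h => hM.spanned_le h.1

lemma degree_eq_two_iff (hM : IsSachs G M) {v : V} :
    (spanned M).degree v = 2 ↔ ∃ w, (cyclePart M).Adj v w :=
  ⟨fun h => (hM.exists_cyclePart_adj h v).imp fun _ h => h.2, fun ⟨_, h⟩ => h.2.1⟩

/-- The edges of a Sachs subgraph outside a set containing all vertices of degree `2` form a
matching. -/
lemma filter_mem_matchings (hM : IsSachs G M) {C : Finset V}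
    (hC : ∀ v, (spanned M).degree v = 2 → v ∈ C) :
    M.filter (fun f => ∀ v ∈ f, v ∉ C) ∈ matchings G (Finset.univ \ C) := by
  rw [mem_matchings]
  refine ⟨fun f hf => ?_, fun f hf g hg v hvf hvg => ?_⟩
  · rw [Finset.mem_filter] at hf
    exact ⟨hM.1 hf.1, fun v hv => by simpa using hf.2 v hv⟩
  · rw [Finset.mem_filter] at hf hg
    obtain ⟨a, rfl⟩ := Sym2.mem_iff_exists.1 hvf
    obtain ⟨b, rfl⟩ := Sym2.mem_iff_exists.1 hvg
    have ha := hM.spanned_adj_iff.2 hf.1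
    have hb := hM.spanned_adj_iff.2 hg.1
    have h1 := hM.degree_eq_one_of_adj ha fun h => hf.2 v hvf (hC v h)
    rw [← card_neighborFinset_eq_degree, Finset.card_eq_one] at h1
    obtain ⟨c, hc⟩ := h1
    have hac : a ∈ (spanned M).neighborFinset v := by rwa [mem_neighborFinset]
    have hbc : b ∈ (spanned M).neighborFinset v := by rwa [mem_neighborFinset]
    rw [hc, Finset.mem_singleton] at hac hbc
    rw [hac, hbc]

/-- A Sachs subgraph is determined by its cycles and its other edges. -/
lemma subset_of_cyclePart_le (hM : IsSachs G M) (hN : IsSachs G N)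
    (h : cyclePart M ≤ cyclePart N) {C : Finset V}
    (hC : ∀ v, (spanned M).degree v = 2 ↔ v ∈ C)
    (hf : M.filter (fun f => ∀ v ∈ f, v ∉ C) ⊆ N) : M ⊆ N := by
  intro f hfM
  induction f with | _ v w =>
  have hvw := hM.spanned_adj_iff.2 hfM
  by_cases hv : (spanned M).degree v = 2
  · exact hN.spanned_adj_iff.1 (h ((hM.cyclePart_adj_iff hv).2 hvw)).1
  · have hw : (spanned M).degree w ≠ 2 := fun hw => hv (hM.degree_eq_two_of_adj hvw.symm hw)
    rw [Ne, hC] at hw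
    rw [hC] at hv
    refine hf (Finset.mem_filter.2 ⟨hfM, fun u hu => ?_⟩)
    rcases Sym2.mem_iff.1 hu with rfl | rfl <;> assumption

end IsSachs

lemma numCycles_eq_zero [Fintype V] {M : Finset (Sym2 V)}
    (h : ∀ v, (spanned M).degree v ≠ 2) : numCycles M = 0 := by
  rw [numCycles, Nat.card_eq_zero]
  refine Or.inl ⟨fun ⟨c, hc⟩ => ?_⟩
  induction c using ConnectedComponent.ind with | _ v => exact h v (hc v rfl)

/-- A subgraph of minimum positive degree at least `2` of a unicyclic graph uses the non-parent
edge. -/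
lemma eq_bot_of_two_adj [Fintype V] {G K : SimpleGraph V} {x y : V} (d : V → ℕ) (p : V → V)
    (hp : ∀ v w, G.Adj v w → d w ≤ d v → s(v, w) ≠ s(x, y) → w = p v)
    (hK : K ≤ G) (hxy : ¬ K.Adj x y)
    (h : ∀ v w, K.Adj v w → ∃ w' ≠ w, K.Adj v w') : K = ⊥ := by
  by_contra hbot
  obtain ⟨a, b, hab⟩ := ne_bot_iff_exists_adj.1 hbot
  obtain ⟨v, hv, hmax⟩ := Finset.exists_max_image
    (Finset.univ.filter fun v => ∃ w, K.Adj v w) d ⟨a, by simpa using ⟨b, hab⟩⟩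
  simp only [Finset.mem_filter, Finset.mem_univ, true_and] at hv hmax
  have key : ∀ w, K.Adj v w → w = p v := fun w hw => by
    refine hp v w (hK hw) (hmax w ⟨v, hw.symm⟩) fun hcon => hxy ?_
    rwa [← mem_edgeSet, ← hcon, mem_edgeSet]
  obtain ⟨w, hw⟩ := hv
  obtain ⟨w', hne, hw'⟩ := h v w hw
  exact hne ((key w' hw').trans (key w hw).symm)

section Unicyclic

variable [Fintype V] {G : SimpleGraph V} {x y : V} {d : V → ℕ} {p : V → V}

lemma numCycles_le_one (hp : ∀ v w, G.Adj v w → d w ≤ d v → s(v, w) ≠ s(x, y) → w = p v)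
    {M : Finset (Sym2 V)} (hM : IsSachs G M) : numCycles M ≤ 1 := by
  rw [numCycles, Finite.card_le_one_iff_subsingleton]
  have key : ∀ c : (spanned M).ConnectedComponent,
      (∀ v, (spanned M).connectedComponentMk v = c → (spanned M).degree v = 2) →
      c = (spanned M).connectedComponentMk x := by
    intro c hc
    let K : SimpleGraph V :=
      { Adj := fun v w => (spanned M).Adj v w ∧ (spanned M).connectedComponentMk v = c
        symm := ⟨fun v w h => ⟨h.1.symm,
          (ConnectedComponent.connectedComponentMk_eq_of_adj h.1).symm.trans h.2⟩⟩
        loopless := ⟨fun _ h => h.1.ne rfl⟩ }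
    by_cases hxy : K.Adj x y
    · exact hxy.2.symm
    have hbot : K = ⊥ := by
      refine eq_bot_of_two_adj d p hp (fun v w h => hM.spanned_le h.1) hxy fun v w h => ?_
      obtain ⟨w', hne, hw'⟩ := exists_two_adj_of_degree_eq_two (hc v h.2) w
      exact ⟨w', hne, hw', h.2⟩
    induction c using ConnectedComponent.ind with | _ v =>
    obtain ⟨w, -, hw⟩ := exists_two_adj_of_degree_eq_two (hc v rfl) v
    have : K.Adj v w := ⟨hw, rfl⟩
    rw [hbot] at this
    exact this.elim
  exact ⟨fun a b => Subtype.ext ((key a.1 a.2).trans (key b.1 b.2).symm)⟩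

lemma cyclePart_adj_extra (hp : ∀ v w, G.Adj v w → d w ≤ d v → s(v, w) ≠ s(x, y) → w = p v)
    {M : Finset (Sym2 V)} (hM : IsSachs G M) (h : ∃ v, (spanned M).degree v = 2) :
    (cyclePart M).Adj x y := by
  by_contra hxy
  have hbot := eq_bot_of_two_adj d p hp hM.cyclePart_le hxy
    fun v w hvw => hM.exists_cyclePart_adj hvw.2.1 w
  obtain ⟨v, hv⟩ := h
  obtain ⟨w, -, hw⟩ := hM.exists_cyclePart_adj hv v
  rw [hbot] at hw
  exact hw.elim

/-- All Sachs subgraphs of a unicyclic graph that have a cycle have the same one. -/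
lemma cyclePart_eq (hp : ∀ v w, G.Adj v w → d w ≤ d v → s(v, w) ≠ s(x, y) → w = p v)
    {M N : Finset (Sym2 V)} (hM : IsSachs G M) (hN : IsSachs G N)
    (hM2 : ∃ v, (spanned M).degree v = 2) (hN2 : ∃ v, (spanned N).degree v = 2) :
    cyclePart M = cyclePart N := by
  have hsymm : ∀ {M N : Finset (Sym2 V)}, IsSachs G M → IsSachs G N → ∀ v w,
      (cyclePart M).Adj v w → ¬ (cyclePart N).Adj v w →
      ∃ w' ≠ w, ((cyclePart M).Adj v w' ∧ ¬ (cyclePart N).Adj v w') ∨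
        ((cyclePart N).Adj v w' ∧ ¬ (cyclePart M).Adj v w') := by
    intro M N hM hN v w h1 h2
    by_cases hv : (spanned N).degree v = 2
    · have hcard : #((spanned M).neighborFinset v) = #((spanned N).neighborFinset v) := by
        rw [card_neighborFinset_eq_degree, card_neighborFinset_eq_degree, hv, h1.2.1]
      have hw : w ∉ (spanned N).neighborFinset v := by
        rw [mem_neighborFinset]
        exact fun h => h2 ((hN.cyclePart_adj_iff hv).2 h)
      have hnot : ¬ (spanned N).neighborFinset v ⊆ (spanned M).neighborFinset v := fun hsub => by
        rw [Finset.eq_of_subset_of_card_le hsub hcard.le, mem_neighborFinset] at hw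
        exact hw h1.1
      obtain ⟨w', hN', hM'⟩ := Finset.not_subset.1 hnot
      rw [mem_neighborFinset] at hN' hM'
      refine ⟨w', ?_, Or.inr ⟨(hN.cyclePart_adj_iff hv).2 hN', fun h => hM' h.1⟩⟩
      rintro rfl
      exact hM' h1.1
    · obtain ⟨w', hne, hw'⟩ := hM.exists_cyclePart_adj h1.2.1 w
      exact ⟨w', hne, Or.inl ⟨hw', fun h => hv h.2.1⟩⟩
  have hxyM := cyclePart_adj_extra hp hM hM2
  have hxyN := cyclePart_adj_extra hp hN hN2
  have hbot := eq_bot_of_two_adj (K := cyclePart M \ cyclePart N ⊔ cyclePart N \ cyclePart M)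
    d p hp
    (sup_le (sdiff_le.trans hM.cyclePart_le) (sdiff_le.trans hN.cyclePart_le))
    (by simp [hxyM, hxyN]) (fun v w h => by
      simp only [sup_adj, sdiff_adj] at h ⊢
      rcases h with h | h
      · exact hsymm hM hN v w h.1 h.2
      · obtain ⟨w', hne, h'⟩ := hsymm hN hM v w h.1 h.2
        exact ⟨w', hne, h'.symm⟩)
  rw [sup_eq_bot_iff, sdiff_eq_bot_iff, sdiff_eq_bot_iff] at hbot
  exact le_antisymm hbot.1 hbot.2

end Unicyclic

/-- The Sachs subgraphs of a unicyclic graph are its matchings and, if there are others, those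
formed by one cycle, with vertex set `C`, and a matching that avoids it. -/
lemma PS_unicyclic_le_matchings [Fintype V] {G : SimpleGraph V} (hc : G.Connected)
    (he : G.edgeFinset.card = Fintype.card V) :
    PS G ≤ #(matchings G Finset.univ) ∨ ∃ C : Finset V,
      PS G ≤ #(matchings G Finset.univ) + 2 * #(matchings G (Finset.univ \ C)) ∧
      #(matchings G (Finset.univ \ C)) ≤ Nat.fib (Fintype.card V - #C + 1) ∧ 3 ≤ #C ∧
      (#C = 3 → ∃ x y z, C = {x, y, z} ∧ G.Adj x y ∧ G.Adj x z ∧ G.Adj y z) := by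
  obtain ⟨r⟩ := hc.nonempty
  obtain ⟨x, y, hxy, p, hp'⟩ := exists_parent hc he r
  have hp : ∀ v w, G.Adj v w → G.dist w r ≤ G.dist v r → s(v, w) ≠ s(x, y) → w = p v :=
    fun v w h1 h2 h3 => (hp' v w h1 h2 h3).1
  set 𝒮 := Finset.univ.filter fun M : Finset (Sym2 V) => IsSachs G M with h𝒮
  set 𝒞 := 𝒮.filter fun M => ∃ v, (spanned M).degree v = 2 with h𝒞
  have hPS : PS G ≤ #(matchings G Finset.univ) + 2 * #𝒞 := by
    rw [PS, ← h𝒮, ← Finset.sum_filter_add_sum_filter_not 𝒮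
      (fun M => ∃ v, (spanned M).degree v = 2), add_comm, ← h𝒞]
    refine add_le_add ?_ ?_
    · rw [Finset.sum_congr rfl (g := fun _ => 1), ← Finset.card_eq_sum_ones]
      · refine Finset.card_le_card fun M hM => ?_
        simp only [h𝒮, Finset.mem_filter, Finset.mem_univ, true_and, not_exists] at hM
        have := hM.1.filter_mem_matchings (C := ∅) fun v hv => (hM.2 v hv).elim
        simpa using this
      · intro M hM
        simp only [Finset.mem_filter, not_exists] at hM
        rw [numCycles_eq_zero hM.2, pow_zero]
    · rw [mul_comm]
      refine Finset.sum_le_card_nsmul _ _ _ fun M hM => ?_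
      simp only [h𝒞, h𝒮, Finset.mem_filter, Finset.mem_univ, true_and] at hM
      exact (Nat.pow_le_pow_right (by norm_num) (numCycles_le_one hp hM.1)).trans_eq (pow_one 2)
  obtain h0 | ⟨N, hN⟩ := 𝒞.eq_empty_or_nonempty
  · left
    simpa [h0] using hPS
  right
  have h𝒞mem : ∀ {M}, M ∈ 𝒞 ↔ IsSachs G M ∧ ∃ v, (spanned M).degree v = 2 := by
    intro M
    simp [h𝒞, h𝒮]
  rw [h𝒞mem] at hN
  set C := Finset.univ.filter fun v => (spanned N).degree v = 2 with hC
  have hmemC : ∀ v, v ∈ C ↔ (spanned N).degree v = 2 := by simp [hC]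
  have hnbr : ∀ v ∈ C, (spanned N).neighborFinset v ⊆ C.erase v := fun v hv w hw => by
    rw [mem_neighborFinset] at hw
    exact Finset.mem_erase.2
      ⟨hw.ne', (hmemC w).2 (hN.1.degree_eq_two_of_adj hw ((hmemC v).1 hv))⟩
  have hdeg : ∀ v ∈ C, #((spanned N).neighborFinset v) = 2 := fun v hv => by
    rw [card_neighborFinset_eq_degree, (hmemC v).1 hv]
  have hcard : #𝒞 ≤ #(matchings G (Finset.univ \ C)) := by
    have hCM : ∀ M ∈ 𝒞, ∀ v, (spanned M).degree v = 2 ↔ v ∈ C := fun M hM v => by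
      rw [h𝒞mem] at hM
      rw [hmemC, hM.1.degree_eq_two_iff, hN.1.degree_eq_two_iff,
        cyclePart_eq hp hM.1 hN.1 hM.2 hN.2]
    refine Finset.card_le_card_of_injOn (fun M => M.filter fun f => ∀ v ∈ f, v ∉ C)
      (fun M hM => (h𝒞mem.1 hM).1.filter_mem_matchings fun v => (hCM M hM v).1) ?_
    intro M hM M' hM' h
    have h1 := h𝒞mem.1 hM
    have h2 := h𝒞mem.1 hM'
    have hcyc := cyclePart_eq hp h1.1 h2.1 h1.2 h2.2
    exact Finset.Subset.antisymm
      (h1.1.subset_of_cyclePart_le h2.1 hcyc.le (hCM M hM)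
        (h.subset.trans (Finset.filter_subset _ _)))
      (h2.1.subset_of_cyclePart_le h1.1 hcyc.ge (hCM M' hM')
        (h.symm.subset.trans (Finset.filter_subset _ _)))
  refine ⟨C, hPS.trans (by omega), ?_, ?_, ?_⟩
  · rw [← Finset.card_univ, ← Finset.card_sdiff_of_subset (Finset.subset_univ C)]
    refine card_matchings_forest_le (G.dist · r) p _ fun v hv w hw hvw hd => hp v w hvw hd ?_
    intro hcon
    have hx : x ∈ C := (hmemC x).2 (cyclePart_adj_extra hp hN.1 hN.2).2.1
    have : x ∈ s(v, w) := by simp [hcon]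
    rcases Sym2.mem_iff.1 this with rfl | rfl
    · exact (Finset.mem_sdiff.1 hv).2 hx
    · exact (Finset.mem_sdiff.1 hw).2 hx
  · obtain ⟨v, hv⟩ := hN.2
    rw [← hmemC] at hv
    have h1 := Finset.card_le_card (hnbr v hv)
    have h2 := Finset.card_erase_add_one hv
    rw [hdeg v hv] at h1
    omega
  · intro h3
    have hadj : ∀ v ∈ C, ∀ w ∈ C, v ≠ w → G.Adj v w := by
      intro v hv w hw hvw
      have h2 := Finset.card_erase_add_one hv
      have heq := Finset.eq_of_subset_of_card_le (hnbr v hv) (by rw [hdeg v hv]; omega)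
      have : w ∈ (spanned N).neighborFinset v := heq ▸ Finset.mem_erase.2 ⟨hvw.symm, hw⟩
      rw [mem_neighborFinset] at this
      exact hN.1.spanned_le this
    obtain ⟨a, b, c, hab, hac, hbc, hCeq⟩ := Finset.card_eq_three.1 h3
    exact ⟨a, b, c, hCeq, hadj a (by simp [hCeq]) b (by simp [hCeq]) hab,
      hadj a (by simp [hCeq]) c (by simp [hCeq]) hac,
      hadj b (by simp [hCeq]) c (by simp [hCeq]) hbc⟩

/-- A unicyclic graph on `k + 5` vertices has permanental sum at most
`6 F (k + 3) + 2 F (k + 2)`. -/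
lemma PS_unicyclic_le [Fintype V] {G : SimpleGraph V} (hc : G.Connected)
    (he : G.edgeFinset.card = Fintype.card V) {k : ℕ} (hk : Fintype.card V = k + 5) :
    PS G ≤ 6 * Nat.fib (k + 3) + 2 * Nat.fib (k + 2) := by
  have h0 : Nat.fib k ≤ Nat.fib (k + 1) := Nat.fib_le_fib_succ
  have h2 : Nat.fib (k + 2) = Nat.fib k + Nat.fib (k + 1) := Nat.fib_add_two
  have h3 : Nat.fib (k + 3) = Nat.fib (k + 1) + Nat.fib (k + 2) := Nat.fib_add_two
  have h4 : Nat.fib (k + 4) = Nat.fib (k + 2) + Nat.fib (k + 3) := Nat.fib_add_two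
  have h5 : Nat.fib (k + 5) = Nat.fib (k + 3) + Nat.fib (k + 4) := Nat.fib_add_two
  have h6 : Nat.fib (k + 6) = Nat.fib (k + 4) + Nat.fib (k + 5) := Nat.fib_add_two
  have huniv : #(Finset.univ : Finset V) = k + 2 + 3 := by rw [Finset.card_univ, hk]
  have hm := card_matchings_unicyclic_le hc he Finset.univ
  rw [huniv, show k + 2 + 3 + 1 = k + 6 by omega, show k + 2 + 3 - 1 = k + 4 by omega] at hm
  obtain h | ⟨C, hPS, hforest, hC3, htri⟩ := PS_unicyclic_le_matchings hc he
  · omega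
  obtain hC | hC := hC3.eq_or_lt
  · obtain ⟨x, y, z, rfl, hxy, hxz, hyz⟩ := htri hC.symm
    exact hPS.trans (card_matchings_triangle_le hc he hxy hxz hyz (k + 2) Finset.univ
      (Finset.subset_univ _) huniv)
  · have : Nat.fib (Fintype.card V - #C + 1) ≤ Nat.fib (k + 2) := Nat.fib_mono (by omega)
    omega

/-- The edges whose image under `f` belongs to `M`. -/
def pullEdges {α β : Type*} [Fintype α] (f : α → β) (M : Finset (Sym2 β)) : Finset (Sym2 α) :=
  Finset.univ.filter fun e => e.map f ∈ M

lemma mem_pullEdges {α β : Type*} [Fintype α] {f : α → β} {M : Finset (Sym2 β)} {e : Sym2 α} :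
    e ∈ pullEdges f M ↔ e.map f ∈ M := by
  simp [pullEdges]

section Pull

variable [Fintype V] {G : SimpleGraph V} {H : SimpleGraph W} {f : V ↪ W} {M : Finset (Sym2 W)}

lemma spanned_pullEdges_adj {v w : V} :
    (spanned (pullEdges f M)).Adj v w ↔ (spanned M).Adj (f v) (f w) := by
  simp [mem_pullEdges]

variable [Fintype W]

lemma degree_pullEdges (hf : ∀ v w, (spanned M).Adj (f v) w → ∃ w', f w' = w) (v : V) :
    (spanned (pullEdges f M)).degree v = (spanned M).degree (f v) := by
  rw [← card_neighborFinset_eq_degree, ← card_neighborFinset_eq_degree,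
    ← Finset.card_map f]
  congr 1
  ext w
  simp only [Finset.mem_map, mem_neighborFinset, spanned_pullEdges_adj]
  constructor
  · rintro ⟨a, ha, rfl⟩
    exact ha
  · intro h
    obtain ⟨a, rfl⟩ := hf v w h
    exact ⟨a, h, rfl⟩

lemma isSachs_pullEdges (hM : IsSachs H M) (hfG : ∀ v w, H.Adj (f v) (f w) → G.Adj v w)
    (hf : ∀ v w, (spanned M).Adj (f v) w → ∃ w', f w' = w) : IsSachs G (pullEdges f M) := by
  refine ⟨fun e he => ?_, fun v hv => ?_, fun v w hvw hv => ?_⟩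
  · induction e with | _ a b =>
    exact hfG a b (hM.adj_of_mem (mem_pullEdges.1 he))
  · obtain ⟨w, hw⟩ := hv
    have := hM.2.1 (f v) ⟨f w, spanned_pullEdges_adj.1 hw⟩
    rwa [← degree_pullEdges hf v] at this
  · have := hM.2.2 (f v) (f w) (spanned_pullEdges_adj.1 hvw)
    rw [← degree_pullEdges hf v, ← degree_pullEdges hf w] at this
    exact this hv

end Pull

/-- The homomorphism from the pulled back edge set to the original one. -/
def pullHom [Fintype V] (f : V ↪ W) (M : Finset (Sym2 W)) : spanned (pullEdges f M) →g spanned M where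
  toFun := f
  map_rel' h := spanned_pullEdges_adj.1 h

/-- The cycle components counted by `numCycles`. -/
def cycleComponents [Fintype V] (M : Finset (Sym2 V)) : Set (spanned M).ConnectedComponent :=
  {c | ∀ v, (spanned M).connectedComponentMk v = c → (spanned M).degree v = 2}

lemma numCycles_eq_ncard [Fintype V] (M : Finset (Sym2 V)) :
    numCycles M = (cycleComponents M).ncard := rfl

lemma mem_image_cycleComponents [Fintype V] [Fintype W] {f : V ↪ W} {M : Finset (Sym2 W)}
    (hf : ∀ v w, (spanned M).Adj (f v) w → ∃ w', f w' = w) {v : V}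
    (h : (spanned M).connectedComponentMk (f v) ∈ cycleComponents M) :
    (spanned M).connectedComponentMk (f v) ∈
      ConnectedComponent.map (pullHom f M) '' cycleComponents (pullEdges f M) := by
  refine ⟨(spanned (pullEdges f M)).connectedComponentMk v, fun w hw => ?_, rfl⟩
  rw [degree_pullEdges hf]
  refine h (f w) ?_
  rw [ConnectedComponent.eq] at hw ⊢
  exact hw.map (pullHom f M)

lemma exists_inl_of_adj {G : SimpleGraph V} {H : SimpleGraph W} {v : V} {u : V ⊕ W}
    (h : (G ⊕g H).Adj (.inl v) u) : ∃ w, .inl w = u := by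
  cases u with
  | inl w => exact ⟨w, rfl⟩
  | inr w => simp at h

lemma exists_inr_of_adj {G : SimpleGraph V} {H : SimpleGraph W} {v : W} {u : V ⊕ W}
    (h : (G ⊕g H).Adj (.inr v) u) : ∃ w, .inr w = u := by
  cases u with
  | inl w => simp at h
  | inr w => exact ⟨w, rfl⟩

lemma numCycles_sum_le [Fintype V] [Fintype W] {G : SimpleGraph V} {H : SimpleGraph W}
    {M : Finset (Sym2 (V ⊕ W))} (hM : IsSachs (G ⊕g H) M) :
    numCycles M ≤ numCycles (pullEdges (Function.Embedding.inl : V ↪ V ⊕ W) M) +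
      numCycles (pullEdges (Function.Embedding.inr : W ↪ V ⊕ W) M) := by
  simp only [numCycles_eq_ncard]
  refine (Set.ncard_le_ncard (t := ConnectedComponent.map (pullHom Function.Embedding.inl M) ''
    cycleComponents (pullEdges (Function.Embedding.inl : V ↪ V ⊕ W) M) ∪
    ConnectedComponent.map (pullHom Function.Embedding.inr M) ''
    cycleComponents (pullEdges (Function.Embedding.inr : W ↪ V ⊕ W) M))
    (fun c hc => ?_) (Set.toFinite _)).trans ((Set.ncard_union_le _ _).trans
      (add_le_add (Set.ncard_image_le (Set.toFinite _)) (Set.ncard_image_le (Set.toFinite _))))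
  induction c using ConnectedComponent.ind with | _ v =>
  cases v with
  | inl v => exact Or.inl (mem_image_cycleComponents (f := Function.Embedding.inl)
      (fun v w h => exists_inl_of_adj (hM.spanned_le h)) hc)
  | inr v => exact Or.inr (mem_image_cycleComponents (f := Function.Embedding.inr)
      (fun v w h => exists_inr_of_adj (hM.spanned_le h)) hc)

lemma subset_of_pullEdges_eq [Fintype V] [Fintype W] {G : SimpleGraph V} {H : SimpleGraph W}
    {M N : Finset (Sym2 (V ⊕ W))} (hM : IsSachs (G ⊕g H) M)
    (hl : pullEdges (Function.Embedding.inl : V ↪ V ⊕ W) M =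
      pullEdges (Function.Embedding.inl : V ↪ V ⊕ W) N)
    (hr : pullEdges (Function.Embedding.inr : W ↪ V ⊕ W) M =
      pullEdges (Function.Embedding.inr : W ↪ V ⊕ W) N) : M ⊆ N := by
  intro e he
  induction e with | _ a b =>
  have hab := hM.adj_of_mem he
  cases a with
  | inl a =>
    obtain ⟨b, rfl⟩ := exists_inl_of_adj hab
    have : s(a, b) ∈ pullEdges (Function.Embedding.inl : V ↪ V ⊕ W) M := mem_pullEdges.2 he
    rw [hl] at this
    exact mem_pullEdges.1 this
  | inr a =>
    obtain ⟨b, rfl⟩ := exists_inr_of_adj hab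
    have : s(a, b) ∈ pullEdges (Function.Embedding.inr : W ↪ V ⊕ W) M := mem_pullEdges.2 he
    rw [hr] at this
    exact mem_pullEdges.1 this

/-- The permanental sum is submultiplicative (in fact multiplicative) over disjoint unions. -/
lemma PS_sum_le [Fintype V] [Fintype W] (G : SimpleGraph V) (H : SimpleGraph W) :
    PS (G ⊕g H) ≤ PS G * PS H := by
  rw [PS, PS, PS, Finset.sum_mul_sum, ← Finset.sum_product']
  let φ : Finset (Sym2 (V ⊕ W)) → Finset (Sym2 V) × Finset (Sym2 W) := fun M =>
    (pullEdges (Function.Embedding.inl : V ↪ V ⊕ W) M,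
      pullEdges (Function.Embedding.inr : W ↪ V ⊕ W) M)
  have hinj : Set.InjOn φ (Finset.univ.filter fun M => IsSachs (G ⊕g H) M : Finset _) := by
    intro M hM N hN h
    simp only [Finset.coe_filter, Finset.mem_univ, true_and, Set.mem_ofPred_eq] at hM hN
    obtain ⟨hl, hr⟩ := Prod.mk.inj h
    exact Finset.Subset.antisymm (subset_of_pullEdges_eq hM hl hr)
      (subset_of_pullEdges_eq hN hl.symm hr.symm)
  calc _ ≤ ∑ M ∈ Finset.univ.filter (fun M => IsSachs (G ⊕g H) M),
        2 ^ numCycles (φ M).1 * 2 ^ numCycles (φ M).2 := by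
        refine Finset.sum_le_sum fun M hM => ?_
        rw [← pow_add]
        exact Nat.pow_le_pow_right (by norm_num) (numCycles_sum_le (Finset.mem_filter.1 hM).2)
    _ = ∑ P ∈ (Finset.univ.filter fun M => IsSachs (G ⊕g H) M).image φ,
        2 ^ numCycles P.1 * 2 ^ numCycles P.2 := by
        rw [Finset.sum_image hinj]
    _ ≤ _ := by
        refine Finset.sum_le_sum_of_subset fun P hP => ?_
        obtain ⟨M, hM, rfl⟩ := Finset.mem_image.1 hP
        have hM' := (Finset.mem_filter.1 hM).2
        simp only [Finset.mem_product, Finset.mem_filter, Finset.mem_univ, true_and]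
        exact ⟨isSachs_pullEdges hM' (fun v w h => by simpa using h)
            fun v w h => exists_inl_of_adj (hM'.spanned_le h),
          isSachs_pullEdges hM' (fun v w h => by simpa using h)
            fun v w h => exists_inr_of_adj (hM'.spanned_le h)⟩

/-- For unicyclic graphs `U_m`, `U_t` on `m, t ≥ 5` vertices with `m + t = n`,
`PS(U_m ⊔ U_t) < 54·F(n-6) + 18·F(n-7)`. -/
theorem PS_two_unicyclic [Fintype V] [Fintype W] (U : SimpleGraph V) (U' : SimpleGraph W)
    (m t n : ℕ) (hm : Fintype.card V = m) (ht : Fintype.card W = t)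
    (hm5 : 5 ≤ m) (ht5 : 5 ≤ t) (hn : m + t = n)
    (hUc : U.Connected) (hUe : U.edgeFinset.card = m)
    (hU'c : U'.Connected) (hU'e : U'.edgeFinset.card = t) :
    PS (U ⊕g U') < 54 * Nat.fib (n - 6) + 18 * Nat.fib (n - 7) := by
  subst hm ht hn
  obtain ⟨i, hi⟩ := Nat.exists_eq_add_of_le' hm5
  obtain ⟨j, hj⟩ := Nat.exists_eq_add_of_le' ht5
  have hPS := (PS_sum_le U U').trans
    (Nat.mul_le_mul (PS_unicyclic_le hUc hUe hi) (PS_unicyclic_le hU'c hU'e hj))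
  refine hPS.trans_lt ?_
  rw [hi, hj, show i + 5 + (j + 5) - 6 = i + 3 + j + 1 by omega,
    show i + 5 + (j + 5) - 7 = i + 2 + j + 1 by omega, Nat.fib_add (i + 3), Nat.fib_add (i + 2)]
  have ei2 : Nat.fib (i + 2) = Nat.fib i + Nat.fib (i + 1) := Nat.fib_add_two
  have ei3 : Nat.fib (i + 3) = Nat.fib (i + 1) + Nat.fib (i + 2) := Nat.fib_add_two
  have ei4 : Nat.fib (i + 3 + 1) = Nat.fib (i + 2) + Nat.fib (i + 3) := Nat.fib_add_two
  have ej2 : Nat.fib (j + 2) = Nat.fib j + Nat.fib (j + 1) := Nat.fib_add_two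
  have ej3 : Nat.fib (j + 3) = Nat.fib (j + 1) + Nat.fib (j + 2) := Nat.fib_add_two
  rw [ei4, ei3, ej3, ei2, ej2]
  have hpos : 0 < Nat.fib (i + 1) * Nat.fib (j + 1) :=
    Nat.mul_pos (Nat.fib_pos.2 (by omega)) (Nat.fib_pos.2 (by omega))
  generalize Nat.fib (i + 1) = b at *
  generalize Nat.fib (j + 1) = d at *
  generalize Nat.fib i = a at *
  generalize Nat.fib j = c at *
  nlinarith [Nat.zero_le (a * c), Nat.zero_le (a * d), Nat.zero_le (b * c)]

end PermSum
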